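/- There exists a universal constant c > 0 with the following property. Let n and k be arbitrary, let L be a closed subset of the Euclidean space ℝⁿ, let p ∈ L, and suppose that every point of the open ball B_{10}(p) has a unique nearest point in L. Suppose moreover that for every q ∈ L ∩ B_4(p) the tangent cone of L at q is a k-dimensional linear subspace T_q L of ℝⁿ. Then for every 0 < r ≤ 3 and every q ∈ L ∩ B_r(p), the tangent spaces vary at most linearly: for every v ∈ T_q L with ‖v‖ = 1, the distance from v to the subspace T_p L satisfies infDist(v, T_p L) ≤ c·r. -/

import Mathlib

namespace TSVL

open Filter Topology Metric

variable {E : Type*} [NormedAddCommGroup E] [InnerProductSpace ℝ E] [FiniteDimensional ℝ E]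

/-- Growth of the distance function in the gradient direction. -/
lemma grow {L : Set E} (hL : IsClosed L) {z y : E} (hy : y ∈ L)
    (hzy : dist z y = infDist z L)
    (huniq : ∀ y' ∈ L, dist z y' = infDist z L → y' = y) (hd : 0 < infDist z L)
    {η : ℝ} (hη0 : 0 ≤ η) (hη : η < 1) {ε : ℝ} (hε : 0 < ε) :
    ∃ t : ℝ, 0 < t ∧ t < ε ∧
      infDist z L + η * (t * infDist z L) ≤ infDist (z + t • (z - y)) L := by
  have : ProperSpace E := FiniteDimensional.proper_real E
  by_contra! hcon
  have hne : L.Nonempty := ⟨y, hy⟩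
  set d := infDist z L with hd_def
  have hnorm : ‖z - y‖ = d := by rw [← dist_eq_norm]; exact hzy
  let t : ℕ → ℝ := fun j => ε / ((j : ℝ) + 2)
  have ht0 : ∀ j, 0 < t j := fun j => by positivity
  have htε : ∀ j, t j < ε := fun j => by
    have : (0 : ℝ) ≤ j := Nat.cast_nonneg j
    rw [div_lt_iff₀ (by positivity)]
    nlinarith
  have htlim : Tendsto t atTop (𝓝 0) := by
    apply Tendsto.const_div_atTop
    exact tendsto_atTop_add_const_right _ _ tendsto_natCast_atTop_atTop
  choose Y hYL hYd using fun j => hL.exists_infDist_eq_dist hne (z + t j • (z - y))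
  have hx : Tendsto (fun j => z + t j • (z - y)) atTop (𝓝 z) := by
    simpa using (tendsto_const_nhds (x := z)).add (htlim.smul_const (z - y))
  have hbdd : Bornology.IsBounded (Set.range Y) := by
    rw [isBounded_iff_subset_closedBall z]
    refine ⟨2 * (ε * d) + d, ?_⟩
    rintro _ ⟨j, rfl⟩
    rw [mem_closedBall, dist_comm]
    have h1 : dist z (z + t j • (z - y)) ≤ ε * d := by
      rw [dist_self_add_right, norm_smul, Real.norm_of_nonneg (ht0 j).le, hnorm]
      gcongr
      exact (htε j).le
    have h2 : infDist (z + t j • (z - y)) L ≤ d + ε * d := by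
      have := infDist_le_infDist_add_dist (s := L) (x := z + t j • (z - y)) (y := z)
      rw [dist_comm] at this
      linarith
    have h3 := dist_triangle z (z + t j • (z - y)) (Y j)
    rw [← hYd] at h3
    linarith
  obtain ⟨y', -, φ, hφ, hlim⟩ := tendsto_subseq_of_bounded hbdd (fun j => Set.mem_range_self j)
  have hy' : y' ∈ L := hL.mem_of_tendsto hlim (Eventually.of_forall fun j => hYL _)
  have hxφ := hx.comp hφ.tendsto_atTop
  have e1 : Tendsto (fun j => infDist (z + t (φ j) • (z - y)) L) atTop (𝓝 d) :=
    ((continuous_infDist_pt L).tendsto z).comp hxφ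
  have e2 : Tendsto (fun j => infDist (z + t (φ j) • (z - y)) L) atTop (𝓝 (dist z y')) := by
    simp_rw [hYd]
    exact hxφ.dist hlim
  have hyy : y' = y := huniq y' hy' (tendsto_nhds_unique e2 e1)
  have e3 : ∀ j, inner ℝ (z - y) (z - Y j) ≤ η * d ^ 2 := by
    intro j
    have h1 := hcon (t j) (ht0 j) (htε j)
    rw [hYd] at h1
    have h2 : d ≤ ‖z - Y j‖ := by rw [← dist_eq_norm]; exact infDist_le_dist_of_mem (hYL j)
    have h3 : dist (z + t j • (z - y)) (Y j) ^ 2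
        = ‖z - Y j‖ ^ 2 + 2 * t j * inner ℝ (z - y) (z - Y j) + (t j) ^ 2 * d ^ 2 := by
      rw [dist_eq_norm, show z + t j • (z - y) - Y j = (z - Y j) + t j • (z - y) by abel,
        norm_add_sq_real, inner_smul_right, norm_smul, real_inner_comm, mul_pow, hnorm,
        Real.norm_eq_abs, sq_abs]
      ring
    have h4 : dist (z + t j • (z - y)) (Y j) ^ 2 < (d + η * (t j * d)) ^ 2 :=
      pow_lt_pow_left₀ h1 dist_nonneg (by norm_num)
    have h5 : d ^ 2 ≤ ‖z - Y j‖ ^ 2 := pow_le_pow_left₀ hd.le h2 2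
    have h6 : η ^ 2 * (t j * d) ^ 2 ≤ (t j * d) ^ 2 := by
      have : η ^ 2 ≤ 1 := by nlinarith
      nlinarith [sq_nonneg (t j * d)]
    have h7 : t j * inner ℝ (z - y) (z - Y j) ≤ t j * (η * d ^ 2) := by nlinarith
    exact le_of_mul_le_mul_left h7 (ht0 j)
  have e4 : inner ℝ (z - y) (z - y') ≤ η * d ^ 2 := by
    refine le_of_tendsto ((tendsto_const_nhds (x := z - y)).inner
      ((tendsto_const_nhds (x := z)).sub hlim)) (Eventually.of_forall fun j => e3 (φ j))
  rw [hyy, real_inner_self_eq_norm_sq, hnorm] at e4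
  nlinarith [pow_pos hd 2]

/-- Extension of normals, as an inequality (Federer). -/
lemma key {L : Set E} (hL : IsClosed L) {p : E}
    (hu : ∀ x ∈ ball p 10, ∃! q, q ∈ L ∧ dist x q = infDist x L)
    {x y a : E} (hx : x ∈ ball p 5) (hy : y ∈ L) (hxy : dist x y = infDist x L) (ha : a ∈ L) :
    10 * inner ℝ (x - y) (a - y) ≤ infDist x L * ‖a - y‖ ^ 2 := by
  have : ProperSpace E := FiniteDimensional.proper_real E
  set d := infDist x L with hd_def
  have hnorm : ‖x - y‖ = d := by rw [← dist_eq_norm]; exact hxy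
  have hd0 : 0 ≤ d := infDist_nonneg
  rcases hd0.eq_or_lt with h0 | hd
  · rw [← h0, norm_eq_zero] at hnorm
    simp [hnorm, ← h0]
  have hsub : ∀ z ∈ closedBall x 5, z ∈ ball p 10 := fun z hz => by
    rw [mem_closedBall] at hz; rw [mem_ball] at hx ⊢
    linarith [dist_triangle z x p]
  have hcomp : IsCompact (closedBall x (5 : ℝ)) := isCompact_closedBall x 5
  have hne : (closedBall x (5 : ℝ)).Nonempty := ⟨x, by simp⟩
  obtain ⟨z0, hz0, hmax⟩ := hcomp.exists_isMaxOn hne (continuous_infDist_pt L).continuousOn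
  have step : ∀ η : ℝ, 0 ≤ η → η < 1 → d + η * 5 ≤ infDist z0 L := by
    intro η hη0 hη
    obtain ⟨z, hz, hzmax⟩ := hcomp.exists_isMaxOn hne
      (f := fun z => infDist z L - η * dist z x) (by fun_prop)
    have h1 : d ≤ infDist z L - η * dist z x := by
      have := hzmax (show x ∈ closedBall x 5 by simp)
      simpa using this
    have hzd : 0 < infDist z L := by
      have : 0 ≤ η * dist z x := by positivity
      linarith
    have hz5 : dist z x = 5 := by
      refine le_antisymm hz ?_
      by_contra! hlt
      obtain ⟨w, ⟨hwL, hw⟩, hwu⟩ := hu z (hsub z hz)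
      obtain ⟨t, ht0, htε, ht⟩ := grow hL hwL hw (fun y' h1 h2 => hwu y' ⟨h1, h2⟩) hzd
        (η := (1 + η) / 2) (by linarith) (by linarith)
        (ε := (5 - dist z x) / infDist z L) (div_pos (by linarith) hzd)
      rw [lt_div_iff₀ hzd] at htε
      have hdist : dist (z + t • (z - w)) z = t * infDist z L := by
        rw [dist_self_add_left, norm_smul, Real.norm_of_nonneg ht0.le, ← dist_eq_norm, hw]
      have htri := dist_triangle (z + t • (z - w)) z x
      have := hzmax (show z + t • (z - w) ∈ closedBall x 5 by
        rw [mem_closedBall]; linarith)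
      have h2 : infDist (z + t • (z - w)) L - η * dist (z + t • (z - w)) x
          ≤ infDist z L - η * dist z x := this
      have h3 : 0 < t * infDist z L := by positivity
      nlinarith
    have h2 : infDist z L ≤ infDist z0 L := hmax hz
    rw [hz5] at h1
    linarith
  have hz0d : d + 5 ≤ infDist z0 L := by
    by_contra! hlt
    have hdz : d ≤ infDist z0 L := by simpa using step 0 le_rfl one_pos
    have := step ((infDist z0 L - d + 5) / 10) (by linarith) (by linarith)
    linarith
  have hzx : ‖z0 - x‖ ≤ 5 := by rw [← dist_eq_norm]; exact hz0
  have hzy : infDist z0 L ≤ ‖z0 - y‖ := by rw [← dist_eq_norm]; exact infDist_le_dist_of_mem hy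
  have hsum : (x - y) + (z0 - x) = z0 - y := by abel
  have htri := norm_add_le (x - y) (z0 - x)
  rw [hsum] at htri
  have hz5 : ‖z0 - x‖ = 5 := by linarith
  have hS : ‖z0 - y‖ = d + 5 := by linarith
  have hray : SameRay ℝ (x - y) (z0 - x) := by
    rw [sameRay_iff_norm_add, hsum, hS, hnorm, hz5]
  have hsm := hray.norm_smul_eq
  rw [hnorm, hz5] at hsm
  have hdu : d • (z0 - y) = (d + 5) • (x - y) := by
    rw [← hsum, smul_add, hsm, add_smul]
  have hza : d + 5 ≤ ‖(z0 - y) - (a - y)‖ := by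
    rw [sub_sub_sub_cancel_right, ← dist_eq_norm]
    exact hz0d.trans (infDist_le_dist_of_mem ha)
  have hsq : (d + 5) ^ 2 ≤ ‖(z0 - y) - (a - y)‖ ^ 2 := pow_le_pow_left₀ (by linarith) hza 2
  rw [norm_sub_sq_real, hS] at hsq
  have hin : d * inner ℝ (z0 - y) (a - y) = (d + 5) * inner ℝ (x - y) (a - y) := by
    rw [← real_inner_smul_left, hdu, real_inner_smul_left]
  rcases le_or_gt (inner ℝ (x - y) (a - y)) 0 with hneg | hpos
  · have : 0 ≤ d * ‖a - y‖ ^ 2 := by positivity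
    linarith
  · nlinarith

/-- Points on segments between points of `L` are quadratically close to `L`. -/
lemma segment_close {L : Set E} (hL : IsClosed L) {p : E} (hp : p ∈ L)
    (hu : ∀ x ∈ ball p 10, ∃! q, q ∈ L ∧ dist x q = infDist x L)
    {a b : E} (ha : a ∈ L) (ha4 : a ∈ ball p 4) (hb : b ∈ L) (hb4 : b ∈ ball p 4)
    {t : ℝ} (ht0 : 0 ≤ t) (ht1 : t ≤ 1) :
    ∃ y ∈ L, ‖y - (a + t • (b - a))‖ ≤ t * ‖b - a‖ ^ 2 / 5 := by
  have : ProperSpace E := FiniteDimensional.proper_real E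
  set x := a + t • (b - a) with hx
  have hx4 : x ∈ ball p 4 := by
    have := (convex_ball p 4).add_smul_sub_mem ha4 hb4 ⟨ht0, ht1⟩
    exact this
  have hx5 : x ∈ ball p 5 := ball_subset_ball (by norm_num) hx4
  obtain ⟨y, hy, hxy⟩ := hL.exists_infDist_eq_dist ⟨p, hp⟩ x
  refine ⟨y, hy, ?_⟩
  have k1 := key hL hu hx5 hy hxy.symm ha
  have k2 := key hL hu hx5 hy hxy.symm hb
  set d := infDist x L
  have hd5 : d < 4 := (infDist_le_dist_of_mem hp).trans_lt hx4
  have hnorm : ‖x - y‖ = d := by rw [← dist_eq_norm, ← hxy]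
  have hd0 : 0 ≤ d := infDist_nonneg
  rw [norm_sub_rev, hnorm]
  have i1 : (1 - t) * inner ℝ (x - y) (a - y) + t * inner ℝ (x - y) (b - y) = d ^ 2 := by
    rw [← hnorm, ← real_inner_self_eq_norm_sq, ← real_inner_smul_right, ← real_inner_smul_right,
      ← inner_add_right]
    congr 1
    rw [hx]; module
  have i2 : (1 - t) * ‖a - y‖ ^ 2 + t * ‖b - y‖ ^ 2 = d ^ 2 + t * (1 - t) * ‖b - a‖ ^ 2 := by
    have e1 : a - y = (x - y) - t • (b - a) := by rw [hx]; module
    have e2 : b - y = (x - y) + (1 - t) • (b - a) := by rw [hx]; module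
    rw [e1, e2, norm_sub_sq_real, norm_add_sq_real, hnorm, norm_smul, norm_smul,
      real_inner_smul_right, real_inner_smul_right, mul_pow, mul_pow, Real.norm_eq_abs,
      Real.norm_eq_abs, sq_abs, sq_abs]
    ring
  have i3 : 10 * d ^ 2 ≤ d * (d ^ 2 + t * (1 - t) * ‖b - a‖ ^ 2) := by
    rw [← i2, ← i1]
    nlinarith [mul_le_mul_of_nonneg_left k1 (sub_nonneg.2 ht1), mul_le_mul_of_nonneg_left k2 ht0]
  rcases hd0.eq_or_lt with h0 | hd
  · rw [← h0]; positivity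
  have i4 : 10 * d ≤ d ^ 2 + t * (1 - t) * ‖b - a‖ ^ 2 := by
    refine le_of_mul_le_mul_left ?_ hd
    linarith
  have i5 : t * (1 - t) * ‖b - a‖ ^ 2 ≤ t * ‖b - a‖ ^ 2 := by
    have : 0 ≤ t * t * ‖b - a‖ ^ 2 := by positivity
    nlinarith
  nlinarith

/-- nearest points are Lipschitz -/
lemma proj_lip {L : Set E} (hL : IsClosed L) {p : E} (hp : p ∈ L)
    (hu : ∀ x ∈ ball p 10, ∃! q, q ∈ L ∧ dist x q = infDist x L)
    {x x' y y' : E} (hx : x ∈ closedBall p 1) (hx' : x' ∈ closedBall p 1)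
    (hy : y ∈ L) (hxy : dist x y = infDist x L)
    (hy' : y' ∈ L) (hxy' : dist x' y' = infDist x' L) :
    ‖y' - y‖ ≤ 2 * ‖x' - x‖ := by
  have k1 := key hL hu (closedBall_subset_ball (by norm_num) hx) hy hxy hy'
  have k2 := key hL hu (closedBall_subset_ball (by norm_num) hx') hy' hxy' hy
  have d1 : infDist x L ≤ 1 := (infDist_le_dist_of_mem hp).trans hx
  have d2 : infDist x' L ≤ 1 := (infDist_le_dist_of_mem hp).trans hx'
  rw [norm_sub_rev y y'] at k2
  have i1 : inner ℝ (x - y) (y' - y) + inner ℝ (x' - y') (y - y')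
      = ‖y' - y‖ ^ 2 - inner ℝ (x' - x) (y' - y) := by
    rw [← real_inner_self_eq_norm_sq, ← neg_sub y' y, inner_neg_right, ← sub_eq_add_neg,
      ← inner_sub_left, ← inner_sub_left]
    congr 1; abel
  have i2 := real_inner_le_norm (x' - x) (y' - y)
  have n0 := norm_nonneg (y' - y)
  have n1 := norm_nonneg (x' - x)
  by_contra! hlt
  have hpos : 0 < ‖y' - y‖ := by linarith
  nlinarith [mul_le_mul_of_nonneg_right d1 (sq_nonneg ‖y' - y‖),
    mul_le_mul_of_nonneg_right d2 (sq_nonneg ‖y' - y‖)]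


/-- the orthogonal defect of `v` with respect to `W` -/
noncomputable abbrev Q (W : Submodule ℝ E) : E →L[ℝ] E := Wᗮ.starProjection

lemma Q_mem {W : Submodule ℝ E} {v : E} (hv : v ∈ W) : Q W v = 0 := by
  rw [Submodule.starProjection_apply_eq_zero_iff]
  exact W.le_orthogonal_orthogonal hv

lemma Q_le (W : Submodule ℝ E) (v : E) : ‖Q W v‖ ≤ ‖v‖ :=
  Submodule.norm_starProjection_apply_le _ v

lemma Q_le_sub {W : Submodule ℝ E} {v w : E} (hw : w ∈ W) : ‖Q W v‖ ≤ ‖v - w‖ := by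
  have := Q_le W (v - w)
  rwa [map_sub, Q_mem hw, sub_zero] at this

lemma Q_eq (W : Submodule ℝ E) (v : E) : Q W v = v - W.starProjection v := by
  have := W.starProjection_add_starProjection_orthogonal v
  exact eq_sub_of_add_eq' this

lemma infDist_le_Q (W : Submodule ℝ E) (v : E) : infDist v (W : Set E) ≤ ‖Q W v‖ := by
  rw [Q_eq, ← dist_eq_norm]
  exact infDist_le_dist_of_mem (W.starProjection_apply_mem v)

lemma sym {W W' : Submodule ℝ E} (hfin : Module.finrank ℝ W = Module.finrank ℝ W') {δ : ℝ}
    (hδ : δ ≤ 1 / 2) (h : ∀ v ∈ W, ‖Q W' v‖ ≤ δ * ‖v‖) :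
    ∀ u ∈ W', ‖Q W u‖ ≤ 2 * δ * ‖u‖ := by
  intro u hu
  let f : W →ₗ[ℝ] W' := (W'.orthogonalProjectionOnto : E →ₗ[ℝ] W').comp W.subtype
  have hf : ∀ v : W, (f v : E) = W'.starProjection (v : E) := fun v => rfl
  have hinj : Function.Injective f := by
    rw [← LinearMap.ker_eq_bot, LinearMap.ker_eq_bot']
    intro v hv
    have h1 := h v v.2
    rw [Q_eq, ← hf, hv] at h1
    simp only [ZeroMemClass.coe_zero, sub_zero] at h1
    have h2 : ‖(v : E)‖ = 0 := by nlinarith [norm_nonneg (v : E)]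
    exact Subtype.ext (norm_eq_zero.1 h2)
  have hsurj := (LinearMap.injective_iff_surjective_of_finrank_eq_finrank hfin).1 hinj
  obtain ⟨v, hv⟩ := hsurj ⟨u, hu⟩
  have hv' : W'.starProjection (v : E) = u := by rw [← hf, hv]
  have h1 := h v v.2
  rw [Q_eq, hv'] at h1
  have h2 : ‖Q W u‖ ≤ ‖(v : E) - u‖ := by rw [norm_sub_rev]; exact Q_le_sub v.2
  have h3 : ‖(v : E)‖ ≤ ‖u‖ + ‖(v : E) - u‖ := by
    have := norm_add_le u ((v : E) - u)
    simpa using this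
  have h4 := norm_nonneg (v : E)
  have h5 : ‖(v : E)‖ ≤ 2 * ‖u‖ := by nlinarith
  rcases le_or_gt 0 δ with h0 | h0
  · nlinarith
  · have : ‖(v : E)‖ = 0 := by nlinarith [norm_nonneg ((v : E) - u)]
    have h6 : u = 0 := by rw [← hv', norm_eq_zero.1 this, map_zero]
    simp [h6]

lemma quad {L : Set E} (hL : IsClosed L) {p : E} (hp : p ∈ L)
    (hu : ∀ x ∈ ball p 10, ∃! q, q ∈ L ∧ dist x q = infDist x L)
    {a b : E} (ha : a ∈ L) (ha4 : a ∈ ball p 4) (hb : b ∈ L) (hb4 : b ∈ ball p 4)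
    {W : Submodule ℝ E} (hW : tangentConeAt ℝ L a = (W : Set E)) :
    ‖Q W (b - a)‖ ≤ ‖b - a‖ ^ 2 / 5 := by
  have : ProperSpace E := FiniteDimensional.proper_real E
  have ht1 : ∀ j : ℕ, 1 / ((j : ℝ) + 1) ≤ 1 := fun j => by
    rw [div_le_one (by positivity)]
    linarith [Nat.cast_nonneg (α := ℝ) j]
  choose y hyL hy using fun j : ℕ =>
    segment_close hL hp hu ha ha4 hb hb4 (t := 1 / ((j : ℝ) + 1)) (by positivity) (ht1 j)
  have hmem : ∀ j : ℕ, ((j : ℝ) + 1) • (y j - a) ∈ closedBall (b - a) (‖b - a‖ ^ 2 / 5) := by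
    intro j
    have hj : (0 : ℝ) < (j : ℝ) + 1 := by positivity
    rw [mem_closedBall, dist_eq_norm]
    have e : ((j : ℝ) + 1) • (y j - a) - (b - a)
        = ((j : ℝ) + 1) • (y j - (a + (1 / ((j : ℝ) + 1)) • (b - a))) := by
      rw [← sub_sub, smul_sub _ (y j - a), smul_smul, mul_one_div_cancel hj.ne', one_smul]
    rw [e, norm_smul, Real.norm_of_nonneg hj.le]
    calc _ ≤ ((j : ℝ) + 1) * (1 / ((j : ℝ) + 1) * ‖b - a‖ ^ 2 / 5) := by gcongr; exact hy j
      _ = _ := by field_simp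
  obtain ⟨w, hw, φ, hφ, hlim⟩ := (isCompact_closedBall _ _).tendsto_subseq hmem
  have htl : Tendsto (fun j : ℕ => 1 / ((j : ℝ) + 1)) atTop (𝓝 0) :=
    tendsto_one_div_add_atTop_nhds_zero_nat
  have hwT : w ∈ tangentConeAt ℝ L a := by
    refine mem_tangentConeAt_of_seq atTop (fun j => ((φ j : ℕ) : ℝ) + 1) (fun j => y (φ j) - a)
      ?_ (Eventually.of_forall fun j => by simpa using hyL (φ j)) hlim
    have := (htl.comp hφ.tendsto_atTop).smul hlim
    rw [zero_smul] at this
    refine this.congr fun j => ?_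
    simp only [Function.comp_apply]
    rw [smul_smul, one_div_mul_cancel (by positivity), one_smul]
  rw [hW] at hwT
  refine (Q_le_sub hwT).trans ?_
  rw [norm_sub_rev, ← dist_eq_norm]
  exact hw

lemma scales {L : Set E} (hL : IsClosed L) {p : E} (hp : p ∈ L)
    (hu : ∀ x ∈ ball p 10, ∃! q, q ∈ L ∧ dist x q = infDist x L)
    {q v : E} (hq : q ∈ L) (hq4 : q ∈ ball p 4) (hv : v ∈ tangentConeAt ℝ L q) (hv1 : ‖v‖ = 1) :
    ∃ t0 : ℝ, 0 < t0 ∧ ∀ s : ℝ, 0 < s → s ≤ t0 → ∃ b ∈ L, ∃ ε : ℝ, |ε| = 1 ∧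
      ‖b - q - s • (ε • v)‖ ≤ s / 4 := by
  obtain ⟨α, l, hl, c, d, hd, hdL, hcd⟩ := exists_fun_of_mem_tangentConeAt hv
  have h1 : ∀ᶠ n in l, ‖c n • d n - v‖ < 1 / 8 := by
    have := (Metric.tendsto_nhds.1 hcd) (1 / 8) (by norm_num)
    simpa only [dist_eq_norm] using this
  have h2 : ∀ᶠ n in l, ‖d n‖ < 1 / 4 := by
    have := (Metric.tendsto_nhds.1 hd) (1 / 4) (by norm_num)
    simpa only [dist_zero_right] using this
  have h3 : ∀ᶠ n in l, q + d n ∈ ball p 4 := by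
    have : Tendsto (fun n => q + d n) l (𝓝 q) := by
      simpa using (tendsto_const_nhds (x := q)).add hd
    exact this (isOpen_ball.mem_nhds hq4)
  obtain ⟨m, m1, m2, m3, m4⟩ := (h1.and (h2.and (h3.and hdL))).exists
  set C := c m
  set x := d m
  have hcx : ‖C • x‖ ≤ 9 / 8 := by
    have := norm_add_le (C • x - v) v
    rw [sub_add_cancel] at this
    linarith
  have hC : C ≠ 0 := by
    intro h
    rw [h, zero_smul, zero_sub, norm_neg, hv1] at m1
    norm_num at m1
  rw [norm_smul, Real.norm_eq_abs] at hcx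
  have hC0 : 0 < |C| := abs_pos.2 hC
  refine ⟨1 / |C|, by positivity, fun s hs0 hs => ?_⟩
  rw [le_div_iff₀ hC0] at hs
  obtain ⟨b, hbL, hb⟩ := segment_close hL hp hu hq hq4 m4 m3 (t := s * |C|) (by positivity) hs
  obtain ⟨ε, hε, hεC⟩ : ∃ ε : ℝ, |ε| = 1 ∧ |C| = ε * C := by
    rcases abs_cases C with ⟨h, _⟩ | ⟨h, _⟩
    · exact ⟨1, by simp, by rw [h]; ring⟩
    · exact ⟨-1, by simp, by rw [h]; ring⟩
  refine ⟨b, hbL, ε, hε, ?_⟩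
  rw [add_sub_cancel_left] at hb
  have e : b - q - s • (ε • v) = (b - (q + (s * |C|) • x)) + (s * ε) • (C • x - v) := by
    rw [hεC]; module
  rw [e]
  refine (norm_add_le _ _).trans ?_
  have n2 : ‖(s * ε) • (C • x - v)‖ ≤ s * (1 / 8) := by
    rw [norm_smul, Real.norm_eq_abs, abs_mul, hε, abs_of_pos hs0, mul_one]
    gcongr
  have n3 : s * |C| * ‖x‖ ^ 2 / 5 ≤ s * (1 / 8) := by
    have : |C| * ‖x‖ * ‖x‖ ≤ 9 / 8 * (1 / 4) := by gcongr
    have := mul_le_mul_of_nonneg_left this hs0.le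
    nlinarith
  linarith

lemma scales_unif {L : Set E} (hL : IsClosed L) {p : E} (hp : p ∈ L)
    (hu : ∀ x ∈ ball p 10, ∃! q, q ∈ L ∧ dist x q = infDist x L)
    {q : E} (hq : q ∈ L) (hq4 : q ∈ ball p 4)
    {W : Submodule ℝ E} (hW : tangentConeAt ℝ L q = (W : Set E)) :
    ∃ t0 : ℝ, 0 < t0 ∧ ∀ v ∈ W, ‖v‖ = 1 → ∀ s : ℝ, 0 < s → s ≤ t0 → ∃ b ∈ L, ∃ ε : ℝ, |ε| = 1 ∧
      ‖b - q - s • (ε • v)‖ ≤ s / 2 := by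
  have : ProperSpace E := FiniteDimensional.proper_real E
  have hK : IsCompact ((W : Set E) ∩ sphere 0 1) :=
    (isCompact_sphere (0 : E) 1).inter_left W.closed_of_finiteDimensional
  have := hK.induction_on (p := fun S => ∃ t0 : ℝ, 0 < t0 ∧ ∀ v ∈ S, ∀ s : ℝ, 0 < s → s ≤ t0 →
    ∃ b ∈ L, ∃ ε : ℝ, |ε| = 1 ∧ ‖b - q - s • (ε • v)‖ ≤ s / 2)
    ⟨1, one_pos, by simp⟩
    (fun S S' hSS' ⟨t, ht, h⟩ => ⟨t, ht, fun v hv => h v (hSS' hv)⟩)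
    (fun S S' ⟨t, ht, h⟩ ⟨t', ht', h'⟩ => ⟨min t t', lt_min ht ht', fun v hv s hs0 hs =>
      hv.elim (fun hv => h v hv s hs0 (hs.trans (min_le_left _ _)))
        (fun hv => h' v hv s hs0 (hs.trans (min_le_right _ _)))⟩)
    (fun v hv => by
      obtain ⟨t, ht, h⟩ := scales hL hp hu hq hq4 (v := v) (by rw [hW]; exact hv.1)
        (by simpa using hv.2)
      refine ⟨ball v (1 / 4), mem_nhdsWithin_of_mem_nhds (ball_mem_nhds v (by norm_num)), t, ht,
        fun v' hv' s hs0 hs => ?_⟩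
      obtain ⟨b, hb, ε, hε, hbn⟩ := h s hs0 hs
      refine ⟨b, hb, ε, hε, ?_⟩
      have e : b - q - s • (ε • v') = (b - q - s • (ε • v)) + (s * ε) • (v - v') := by module
      rw [e]
      refine (norm_add_le _ _).trans ?_
      have n2 : ‖(s * ε) • (v - v')‖ ≤ s * (1 / 4) := by
        rw [norm_smul, Real.norm_eq_abs, abs_mul, hε, abs_of_pos hs0, mul_one, ← dist_eq_norm,
          dist_comm]
        gcongr
        exact (mem_ball.1 hv').le
      linarith)
  obtain ⟨t, ht, h⟩ := this
  exact ⟨t, ht, fun v hv hv1 => h v ⟨hv, by simpa using hv1⟩⟩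

lemma local1 {L : Set E} (hL : IsClosed L) {p : E} (hp : p ∈ L)
    (hu : ∀ x ∈ ball p 10, ∃! q, q ∈ L ∧ dist x q = infDist x L)
    {T : E → Submodule ℝ E} (hT : ∀ q ∈ L, q ∈ ball p 4 → tangentConeAt ℝ L q = (T q : Set E))
    {q : E} (hq : q ∈ L) (hq4 : q ∈ ball p 4) :
    ∃ ρ0 : ℝ, 0 < ρ0 ∧ ∀ q' ∈ L, q' ∈ ball p 4 → ‖q' - q‖ < ρ0 →
      ∀ v ∈ T q, ‖Q (T q') v‖ ≤ 4 * ‖q' - q‖ * ‖v‖ := by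
  obtain ⟨t0, ht0, h⟩ := scales_unif hL hp hu hq hq4 (hT q hq hq4)
  have hq4' := mem_ball.1 hq4
  refine ⟨min t0 ((4 - dist q p) / 2), lt_min ht0 (by linarith), fun q' hq' hq'4 hρ => ?_⟩
  set ρ := ‖q' - q‖ with hρdef
  obtain ⟨hρ1, hρ2⟩ := lt_min_iff.1 hρ
  rcases (norm_nonneg (q' - q)).eq_or_lt with h0 | hρ0
  · intro v hv
    have : q' = q := by rw [← sub_eq_zero, ← norm_eq_zero, ← h0]
    rw [this, Q_mem hv, norm_zero]
    positivity
  rw [← hρdef] at hρ0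
  set A : E →L[ℝ] E := (Q (T q')).comp (T q).starProjection with hA
  have hAW : ∀ v ∈ T q, A v = Q (T q') v := fun v hv => by
    rw [hA, ContinuousLinearMap.comp_apply, Submodule.starProjection_eq_self_iff.2 hv]
  have unit : ∀ v ∈ T q, ‖v‖ = 1 → ‖Q (T q') v‖ ≤ 2 * ρ + ‖A‖ / 2 := by
    intro v hv hv1
    obtain ⟨b, hb, ε, hε, hbn⟩ := h v hv hv1 ρ hρ0 hρ1.le
    have hεv : ‖ρ • (ε • v)‖ = ρ := by
      rw [norm_smul, norm_smul, hv1, Real.norm_eq_abs, Real.norm_eq_abs, hε, abs_of_pos hρ0]; ring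
    have hbq : ‖b - q‖ ≤ 3 / 2 * ρ := by
      have := norm_add_le (b - q - ρ • (ε • v)) (ρ • (ε • v))
      rw [sub_add_cancel] at this
      linarith
    have hb4 : b ∈ ball p 4 := by
      rw [mem_ball]
      have := dist_triangle b q p
      rw [dist_eq_norm b q] at this
      linarith
    have hbq' : ‖b - q'‖ ≤ 5 / 2 * ρ := by
      have := norm_sub_le (b - q) (q' - q)
      rw [sub_sub_sub_cancel_right] at this
      linarith
    have q1 := quad hL hp hu hq hq4 hb hb4 (hT q hq hq4)
    have q2 := quad hL hp hu hq' hq'4 hb hb4 (hT q' hq' hq'4)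
    have q3 := quad hL hp hu hq' hq'4 hq hq4 (hT q' hq' hq'4)
    rw [norm_sub_rev q q', ← hρdef] at q3
    have s1 : ‖b - q‖ ^ 2 ≤ (3 / 2 * ρ) ^ 2 := pow_le_pow_left₀ (norm_nonneg _) hbq 2
    have s2 : ‖b - q'‖ ^ 2 ≤ (5 / 2 * ρ) ^ 2 := pow_le_pow_left₀ (norm_nonneg _) hbq' 2
    set w := (T q).starProjection (b - q) with hw
    have hwT : w ∈ T q := (T q).starProjection_apply_mem _
    have hQw : ‖Q (T q') w‖ ≤ 2 * ρ ^ 2 := by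
      have e : Q (T q') w = Q (T q') (b - q') - Q (T q') (q - q')
          - Q (T q') (Q (T q) (b - q)) := by
        rw [Q_eq (T q), ← map_sub, ← map_sub, ← hw]
        congr 1; abel
      rw [e]
      have n1 := norm_sub_le (Q (T q') (b - q') - Q (T q') (q - q')) (Q (T q') (Q (T q) (b - q)))
      have n2 := norm_sub_le (Q (T q') (b - q')) (Q (T q') (q - q'))
      have n3 := Q_le (T q') (Q (T q) (b - q))
      nlinarith [sq_nonneg ρ]
    have hclose : ‖ρ • (ε • v) - w‖ ≤ ρ / 2 := by
      have e : ρ • (ε • v) - w = - (T q).starProjection (b - q - ρ • (ε • v)) := by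
        rw [map_sub, Submodule.starProjection_eq_self_iff.2
          ((T q).smul_mem ρ ((T q).smul_mem ε hv)), ← hw]
        abel
      rw [e, norm_neg]
      exact (Submodule.norm_starProjection_apply_le _ _).trans hbn
    have e1 : ‖Q (T q') (ρ • (ε • v))‖ = ρ * ‖Q (T q') v‖ := by
      rw [map_smul, map_smul, norm_smul, norm_smul, Real.norm_eq_abs, Real.norm_eq_abs, hε,
        abs_of_pos hρ0, one_mul]
    have e2 : Q (T q') (ρ • (ε • v)) = Q (T q') w + A (ρ • (ε • v) - w) := by
      rw [hAW _ ((T q).sub_mem ((T q).smul_mem ρ ((T q).smul_mem ε hv)) hwT), map_sub]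
      abel
    have e3 : ρ * ‖Q (T q') v‖ ≤ ρ * (2 * ρ + ‖A‖ / 2) := by
      rw [← e1, e2]
      refine (norm_add_le _ _).trans ?_
      have := A.le_opNorm_of_le hclose
      nlinarith
    exact le_of_mul_le_mul_left e3 hρ0
  have unit' : ∀ v ∈ T q, ‖Q (T q') v‖ ≤ (2 * ρ + ‖A‖ / 2) * ‖v‖ := by
    intro v hv
    rcases eq_or_ne v 0 with h0 | h0
    · simp [h0]
    have hn : 0 < ‖v‖ := norm_pos_iff.2 h0
    have := unit (‖v‖⁻¹ • v) ((T q).smul_mem _ hv) (norm_smul_inv_norm h0)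
    rw [map_smul, norm_smul, norm_inv, norm_norm, inv_mul_le_iff₀ hn] at this
    linarith
  have hAn : ‖A‖ ≤ 2 * ρ + ‖A‖ / 2 := by
    have hnn : 0 ≤ 2 * ρ + ‖A‖ / 2 := by positivity
    refine A.opNorm_le_bound hnn fun x => ?_
    refine (unit' _ ((T q).starProjection_apply_mem x)).trans ?_
    gcongr
    exact Submodule.norm_starProjection_apply_le _ _
  intro v hv
  refine (unit' v hv).trans ?_
  gcongr
  linarith

lemma Q_change (W W' : Submodule ℝ E) {κ : ℝ} (hκ0 : 0 ≤ κ) (hκ : ∀ u ∈ W, ‖Q W' u‖ ≤ κ * ‖u‖)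
    (v : E) : ‖Q W' v‖ ≤ ‖Q W v‖ + κ * ‖v‖ := by
  have e : Q W' v = Q W' (Q W v) + Q W' (W.starProjection v) := by
    rw [← map_add, Q_eq W]; simp
  rw [e]
  refine (norm_add_le _ _).trans (add_le_add (Q_le _ _) ?_)
  refine (hκ _ (W.starProjection_apply_mem v)).trans ?_
  gcongr
  exact Submodule.norm_starProjection_apply_le _ _

lemma local2 {L : Set E} (hL : IsClosed L) {p : E} (hp : p ∈ L)
    (hu : ∀ x ∈ ball p 10, ∃! q, q ∈ L ∧ dist x q = infDist x L)
    {T : E → Submodule ℝ E} (hT : ∀ q ∈ L, q ∈ ball p 4 → tangentConeAt ℝ L q = (T q : Set E))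
    {k : ℕ} (hk : ∀ q ∈ L, q ∈ ball p 4 → Module.finrank ℝ (T q) = k)
    {q : E} (hq : q ∈ L) (hq4 : q ∈ ball p 4) :
    ∃ ρ0 : ℝ, 0 < ρ0 ∧ ∀ q' ∈ L, q' ∈ ball p 4 → ‖q' - q‖ < ρ0 →
      ∀ v : E, |‖Q (T q') v‖ - ‖Q (T q) v‖| ≤ 8 * ‖q' - q‖ * ‖v‖ := by
  obtain ⟨ρ0, hρ0, h⟩ := local1 hL hp hu hT hq hq4
  refine ⟨min ρ0 (1 / 8), lt_min hρ0 (by norm_num), fun q' hq' hq'4 hρ v => ?_⟩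
  obtain ⟨h1, h2⟩ := lt_min_iff.1 hρ
  have k1 := h q' hq' hq'4 h1
  have k2 := sym ((hk q hq hq4).trans (hk q' hq' hq'4).symm) (by linarith) k1
  have c1 := Q_change _ _ (by positivity) k1 v
  have c2 := Q_change _ _ (by positivity) k2 v
  have : 0 ≤ ‖q' - q‖ * ‖v‖ := by positivity
  rw [abs_le]
  constructor <;> nlinarith

lemma real_lip {F : ℝ → ℝ} {K : ℝ}
    (h : ∀ t ∈ Set.Icc (0 : ℝ) 1, ∃ τ > 0, ∀ t' ∈ Set.Icc (0 : ℝ) 1, |t' - t| < τ →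
      |F t' - F t| ≤ K * |t' - t|) : F 1 ≤ F 0 + K := by
  have hc : ContinuousOn F (Set.Icc 0 1) := by
    intro t ht
    obtain ⟨τ, hτ, hF⟩ := h t ht
    rw [ContinuousWithinAt, tendsto_iff_dist_tendsto_zero]
    have hl : Tendsto (fun t' => K * |t' - t|) (𝓝[Set.Icc 0 1] t) (𝓝 0) := by
      have : Continuous fun t' : ℝ => K * |t' - t| := by fun_prop
      have := this.tendsto t
      simp only [sub_self, abs_zero, mul_zero] at this
      exact this.mono_left nhdsWithin_le_nhds
    refine squeeze_zero' (Eventually.of_forall fun _ => dist_nonneg) ?_ hl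
    filter_upwards [self_mem_nhdsWithin, mem_nhdsWithin_of_mem_nhds (ball_mem_nhds t hτ)]
      with t' h1 h2
    rw [Real.dist_eq]
    exact hF t' h1 (by rwa [mem_ball, Real.dist_eq] at h2)
  have := image_le_of_liminf_slope_right_le_deriv_boundary (f := F) (a := 0) (b := 1) hc
    (B := fun t => F 0 + K * t) (B' := fun _ => K) (by simp) (by fun_prop)
    (fun x _ => by
      have := ((hasDerivAt_id x).const_mul K).const_add (F 0)
      simpa using this.hasDerivWithinAt)
    (fun x hx r hr => by
      obtain ⟨τ, hτ, hF⟩ := h x ⟨hx.1, hx.2.le⟩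
      apply Eventually.frequently
      filter_upwards [self_mem_nhdsWithin, mem_nhdsWithin_of_mem_nhds (ball_mem_nhds x hτ),
        mem_nhdsWithin_of_mem_nhds (Iio_mem_nhds hx.2)] with t h1 h2 h3
      have hxt : x < t := h1
      have := hF t ⟨hx.1.trans hxt.le, le_of_lt h3⟩ (by rwa [mem_ball, Real.dist_eq] at h2)
      rw [abs_of_pos (sub_pos.2 hxt)] at this
      rw [slope_def_field, div_lt_iff₀ (sub_pos.2 hxt)]
      have h5 := le_abs_self (F t - F x)
      nlinarith [sub_pos.2 hxt])
  have := this (show (1 : ℝ) ∈ Set.Icc 0 1 by simp)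
  simpa using this

lemma main {L : Set E} (hL : IsClosed L) {p : E} (hp : p ∈ L)
    (hu : ∀ x ∈ ball p 10, ∃! q, q ∈ L ∧ dist x q = infDist x L)
    {T : E → Submodule ℝ E} (hT : ∀ q ∈ L, q ∈ ball p 4 → tangentConeAt ℝ L q = (T q : Set E))
    {k : ℕ} (hk : ∀ q ∈ L, q ∈ ball p 4 → Module.finrank ℝ (T q) = k)
    {q : E} (hq : q ∈ L) (hq1 : ‖q - p‖ < 1) {v : E} (hv : v ∈ T q) (hv1 : ‖v‖ = 1) :
    ‖Q (T p) v‖ ≤ 16 * ‖q - p‖ := by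
  have : ProperSpace E := FiniteDimensional.proper_real E
  let x : ℝ → E := fun t => q + t • (p - q)
  choose γ hγL hγd using fun t => hL.exists_infDist_eq_dist ⟨p, hp⟩ (x t)
  have hself : ∀ t, x t ∈ L → γ t = x t := by
    intro t ht
    have := hγd t
    rw [infDist_zero_of_mem ht] at this
    exact (dist_eq_zero.1 this.symm).symm
  have hx0 : x 0 = q := by simp [x]
  have hx1 : x 1 = p := by simp [x]
  have hγ0 : γ 0 = q := by rw [hself 0 (by rwa [hx0]), hx0]
  have hγ1 : γ 1 = p := by rw [hself 1 (by rwa [hx1]), hx1]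
  have hxball : ∀ t ∈ Set.Icc (0 : ℝ) 1, x t ∈ closedBall p 1 := by
    intro t ht
    refine (convex_closedBall p 1).add_smul_sub_mem ?_ (mem_closedBall_self zero_le_one) ht
    rw [mem_closedBall, dist_eq_norm]; exact hq1.le
  have hlip : ∀ t ∈ Set.Icc (0 : ℝ) 1, ∀ t' ∈ Set.Icc (0 : ℝ) 1,
      ‖γ t' - γ t‖ ≤ 2 * (|t' - t| * ‖q - p‖) := by
    intro t ht t' ht'
    have := proj_lip hL hp hu (hxball t ht) (hxball t' ht') (hγL t) (hγd t).symm (hγL t')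
      (hγd t').symm
    have e : x t' - x t = (t' - t) • (p - q) := by simp only [x]; module
    rwa [e, norm_smul, Real.norm_eq_abs, norm_sub_rev p q] at this
  have hγ4 : ∀ t ∈ Set.Icc (0 : ℝ) 1, γ t ∈ ball p 4 := by
    intro t ht
    have h1 := hlip 1 (by simp) t ht
    rw [hγ1] at h1
    rw [mem_ball, dist_eq_norm]
    have h2 : |t - 1| ≤ 1 := by rw [abs_le]; constructor <;> linarith [ht.1, ht.2]
    have h3 : |t - 1| * ‖q - p‖ ≤ 1 * 1 := by gcongr
    linarith
  have hF := real_lip (F := fun t => ‖Q (T (γ t)) v‖) (K := 16 * ‖q - p‖) (by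
    intro t ht
    obtain ⟨ρ0, hρ0, h⟩ := local2 hL hp hu hT hk (hγL t) (hγ4 t ht)
    refine ⟨ρ0 / 2, by positivity, fun t' ht' htt => ?_⟩
    have hl := hlip t ht t' ht'
    have h3 : |t' - t| * ‖q - p‖ ≤ |t' - t| * 1 := by gcongr
    have := h (γ t') (hγL t') (hγ4 t' ht') (by linarith) v
    rw [hv1] at this
    refine this.trans ?_
    linarith)
  simp only [hγ0, hγ1, Q_mem hv, norm_zero, zero_add] at hF
  exact hF

end TSVL


/-- There is a universal constant `c > 0` such that: whenever `L` is a closed subset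
of Euclidean space `ℝⁿ` containing a point `p`, every point of `B₁₀(p)` has a unique
nearest point in `L`, and at every point `q ∈ L ∩ B₄(p)` the tangent cone of `L` is a
`k`-dimensional linear subspace `T_q L`, then for every `0 < r ≤ 3` and every
`q ∈ L ∩ B_r(p)`, every unit vector `v ∈ T_q L` satisfies
`infDist(v, T_p L) ≤ c·r`. -/
theorem tangent_spaces_vary_lipschitz :
    ∃ c : ℝ, 0 < c ∧
      ∀ (n k : ℕ) (L : Set (EuclideanSpace ℝ (Fin n))) (p : EuclideanSpace ℝ (Fin n)),
        IsClosed L → p ∈ L →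
        (∀ x ∈ Metric.ball p 10, ∃! q, q ∈ L ∧ dist x q = Metric.infDist x L) →
        (∀ q ∈ L ∩ Metric.ball p 4, ∃ W : Submodule ℝ (EuclideanSpace ℝ (Fin n)),
          Module.finrank ℝ W = k ∧ tangentConeAt ℝ L q = (W : Set (EuclideanSpace ℝ (Fin n)))) →
        ∀ r : ℝ, 0 < r → r ≤ 3 → ∀ q ∈ L ∩ Metric.ball p r,
          ∀ v ∈ tangentConeAt ℝ L q, ‖v‖ = 1 →
            Metric.infDist v (tangentConeAt ℝ L p) ≤ c * r := by
  refine ⟨16, by norm_num, ?_⟩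
  intro n k L p hL hp hu hT r hr0 hr3 q hq v hv hv1
  classical
  have hT' : ∀ q : EuclideanSpace ℝ (Fin n), ∃ W : Submodule ℝ (EuclideanSpace ℝ (Fin n)),
      q ∈ L → q ∈ Metric.ball p 4 → Module.finrank ℝ W = k ∧
        tangentConeAt ℝ L q = (W : Set (EuclideanSpace ℝ (Fin n))) := by
    intro q
    by_cases h : q ∈ L ∩ Metric.ball p 4
    · obtain ⟨W, hW⟩ := hT q h
      exact ⟨W, fun _ _ => hW⟩
    · exact ⟨⊥, fun h1 h2 => absurd ⟨h1, h2⟩ h⟩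
  choose T hTT using hT'
  have hp4 : p ∈ Metric.ball p 4 := Metric.mem_ball_self (by norm_num)
  have hqr : ‖q - p‖ < r := by rw [← dist_eq_norm]; exact hq.2
  have hq4 : q ∈ Metric.ball p 4 := by
    rw [Metric.mem_ball, dist_eq_norm]; linarith
  rw [(hTT p hp hp4).2]
  rw [(hTT q hq.1 hq4).2] at hv
  refine (TSVL.infDist_le_Q _ v).trans ?_
  rcases le_or_gt 1 r with h1 | h1
  · have := TSVL.Q_le (T p) v
    linarith
  · have := TSVL.main hL hp hu (T := T) (fun q h h' => (hTT q h h').2)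
      (fun q h h' => (hTT q h h').1) hq.1 (by linarith) hv hv1
    linarith
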